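/- Let N ≥ 2 be an integer and r ≥ 1. The set of x ∈ [0,1) such that the set of accumulation points (with respect to the ℓ¹-norm) of the sequence of r-th iterated Cesàro averages (Π_1^{(r)}(x,n))_{n≥1} equals the full simplex Δ_1 of probability vectors on {0,…,N−1} is residual in [0,1). -/

import Mathlib

open Filter Topology Set

namespace BaseN

/-- The ℓ¹ distance between two finitely-indexed real vectors. -/
noncomputable def dist1 {α : Type*} [Fintype α] (p q : α → ℝ) : ℝ :=
  ∑ b, |p b - q b|

/-- The simplex of probability vectors indexed by `α`. -/
def Simplex (α : Type*) [Fintype α] : Set (α → ℝ) :=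
  {p | (∀ b, 0 ≤ p b) ∧ ∑ b, p b = 1}

/-- The set of accumulation points, in the simplex with the ℓ¹ norm, of a sequence
of vectors. -/
def AccPts {α : Type*} [Fintype α] (f : ℕ → (α → ℝ)) : Set (α → ℝ) :=
  {p | p ∈ Simplex α ∧ ∀ ε : ℝ, 0 < ε → ∀ n₀ : ℕ, ∃ n, n₀ ≤ n ∧ dist1 (f n) p < ε}

/-- `d : ℝ → ℕ → Fin N` assigns to each `x ∈ [0,1)` the digit sequence
`d x 0, d x 1, …` (so `d x h = d_{h+1}(x)`) of its unique non-terminating base-`N`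
expansion: the digits sum to `x`, and for `x ≠ 0` the digit sequence is not
eventually zero. -/
def IsNonTerminatingDigits {N : ℕ} (d : ℝ → ℕ → Fin N) : Prop :=
  ∀ x ∈ Set.Ico (0 : ℝ) 1,
    HasSum (fun h : ℕ => (d x h : ℝ) / (N : ℝ) ^ (h + 1)) x ∧
    (x ≠ 0 → ∀ H : ℕ, ∃ h, H ≤ h ∧ (d x h : ℕ) ≠ 0)

/-- `bfreq d x b n` is the frequency `Π(x,b,n)` of the block `b` among the first
`n` digits of `x`. -/
noncomputable def bfreq {N : ℕ} (d : ℝ → ℕ → Fin N) (x : ℝ) (b : List (Fin N))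
    (n : ℕ) : ℝ :=
  (((Finset.range n).filter fun i =>
      (List.ofFn fun m : Fin b.length => d x (i + (m : ℕ))) = b).card : ℝ) / n

/-- `Π_k(x,n)`: the vector of frequencies of all blocks of length `k` among the
first `n` digits of `x`. -/
noncomputable def bfreqVec {N : ℕ} (d : ℝ → ℕ → Fin N) (x : ℝ) (k n : ℕ) :
    (Fin k → Fin N) → ℝ :=
  fun b => bfreq d x (List.ofFn b) n

/-- The iterated Cesàro averages of the single-digit frequencies:
`bcfreq d x 0 i n = Π(x,i,n)` and
`bcfreq d x (r+1) i n = (∑_{j=1}^n bcfreq d x r i j)/n`. -/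
noncomputable def bcfreq {N : ℕ} (d : ℝ → ℕ → Fin N) (x : ℝ) :
    ℕ → Fin N → ℕ → ℝ
  | 0, i, n => bfreq d x [i] n
  | r + 1, i, n => (∑ j ∈ Finset.Icc 1 n, bcfreq d x r i j) / n

/-- `Π_1^{(r)}(x,n)`: the vector of `r`-th iterated Cesàro averages of the
single-digit frequencies. -/
noncomputable def bcfreqVec {N : ℕ} (d : ℝ → ℕ → Fin N) (x : ℝ) (r n : ℕ) :
    Fin N → ℝ :=
  fun i => bcfreq d x r i n

lemma bfreq_single {N : ℕ} (d : ℝ → ℕ → Fin N) (x : ℝ) (i : Fin N) (n : ℕ) :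
    bfreq d x [i] n = (∑ h ∈ Finset.range n, if d x h = i then (1 : ℝ) else 0) / n := by
  unfold bfreq
  congr 1
  rw [Finset.card_filter]
  push_cast
  refine Finset.sum_congr rfl fun h _ => ?_
  have : (List.ofFn fun m : Fin ([i] : List (Fin N)).length => d x (h + (m : ℕ))) = [d x h] := by
    show (List.ofFn fun m : Fin 1 => d x (h + (m : ℕ))) = [d x h]
    simp
  rw [this]
  simp

lemma bcfreq_congr {N : ℕ} (d d' : ℝ → ℕ → Fin N) (x x' : ℝ) (r : ℕ) (i : Fin N) :
    ∀ n : ℕ, (∀ h < n, d x h = d' x' h) → bcfreq d x r i n = bcfreq d' x' r i n := by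
  induction r with
  | zero =>
    intro n hn
    simp only [bcfreq, bfreq_single]
    congr 1
    refine Finset.sum_congr rfl fun h hh => ?_
    rw [hn h (Finset.mem_range.1 hh)]
  | succ r ih =>
    intro n hn
    simp only [bcfreq]
    congr 1
    refine Finset.sum_congr rfl fun j hj => ?_
    exact ih j fun h hh => hn h (lt_of_lt_of_le hh (Finset.mem_Icc.1 hj).2)

lemma bcfreq_tendsto {N : ℕ} (d : ℝ → ℕ → Fin N) (x : ℝ) (i : Fin N) (p : ℝ)
    (h0 : Tendsto (fun n => bfreq d x [i] n) atTop (𝓝 p)) (r : ℕ) :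
    Tendsto (fun n => bcfreq d x r i n) atTop (𝓝 p) := by
  induction r with
  | zero => simpa only [bcfreq] using h0
  | succ r ih =>
    have h1 := ((tendsto_add_atTop_iff_nat 1).2 ih).cesaro
    refine h1.congr fun n => ?_
    simp only [bcfreq]
    rw [div_eq_inv_mul, Finset.range_eq_Ico, Finset.sum_Ico_add' (fun j => bcfreq d x r i j) 0 n 1]
    rfl

/-- counts of digit `i` in the first `n` terms -/
noncomputable def cnt {N : ℕ} (e : ℕ → Fin N) (i : Fin N) (n : ℕ) : ℝ :=
  ∑ h ∈ Finset.range n, if e h = i then (1 : ℝ) else 0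

lemma greedy_step {N : ℕ} (p c : Fin N → ℝ) (n : ℕ)
    (hs : ∑ i, (((n : ℝ) + 1) * p i - c i) = 1) :
    ∃ i, 0 < ((n : ℝ) + 1) * p i - c i := by
  by_contra! h
  have : ∑ i, (((n : ℝ) + 1) * p i - c i) ≤ 0 := Finset.sum_nonpos fun i _ => h i
  linarith

open Classical in
/-- greedy choice of the next digit -/
noncomputable def pick {N : ℕ} (i0 : Fin N) (p : Fin N → ℝ) (n : ℕ) (c : Fin N → ℝ) : Fin N :=
  if h : ∃ i, 0 < ((n : ℝ) + 1) * p i - c i then h.choose else i0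

/-- greedy counts -/
noncomputable def gc {N : ℕ} (i0 : Fin N) (p : Fin N → ℝ) : ℕ → Fin N → ℝ
  | 0 => fun _ => 0
  | n + 1 => fun i => gc i0 p n i + if pick i0 p n (gc i0 p n) = i then 1 else 0

lemma gc_inv {N : ℕ} (i0 : Fin N) (p : Fin N → ℝ) (hp : p ∈ Simplex (Fin N)) (n : ℕ) :
    (∑ i, gc i0 p n i = n) ∧ ∀ i, gc i0 p n i ≤ n * p i + 1 := by
  induction n with
  | zero => simp [gc]
  | succ n ih =>
    obtain ⟨ih1, ih2⟩ := ih
    have hs : ∑ i, (((n : ℝ) + 1) * p i - gc i0 p n i) = 1 := by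
      rw [Finset.sum_sub_distrib, ← Finset.mul_sum, hp.2, ih1]; ring
    have hex := greedy_step p _ n hs
    have hpick : 0 < ((n : ℝ) + 1) * p (pick i0 p n (gc i0 p n))
        - gc i0 p n (pick i0 p n (gc i0 p n)) := by
      have : pick i0 p n (gc i0 p n) = hex.choose := by
        unfold pick; rw [dif_pos hex]
      rw [this]
      exact hex.choose_spec
    refine ⟨?_, fun i => ?_⟩
    · simp [gc, Finset.sum_add_distrib, ih1]
    · simp only [gc]
      push_cast
      split_ifs with h
      · rw [h] at hpick; linarith
      · have := ih2 i; have := hp.1 i; linarith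

lemma exists_seq {N : ℕ} (hN : 2 ≤ N) (p : Fin N → ℝ) (hp : p ∈ Simplex (Fin N)) :
    ∃ e : ℕ → Fin N, ∀ i n, |cnt e i n - n * p i| ≤ N := by
  let i0 : Fin N := ⟨0, by omega⟩
  let e : ℕ → Fin N := fun n => pick i0 p n (gc i0 p n)
  have hc : ∀ n i, cnt e i n = gc i0 p n i := by
    intro n
    induction n with
    | zero => intro i; simp [cnt, gc]
    | succ n ih =>
      intro i
      have := ih i
      unfold cnt at this ⊢
      rw [Finset.sum_range_succ, this]
      rfl
  refine ⟨e, fun i n => ?_⟩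
  rw [hc]
  obtain ⟨h1, h2⟩ := gc_inv i0 p hp n
  have hN' : (2 : ℝ) ≤ N := by exact_mod_cast hN
  rw [abs_le]
  refine ⟨?_, by linarith [h2 i]⟩
  have h3 : ∑ j, (n * p j + 1 - gc i0 p n j) = N := by
    rw [Finset.sum_sub_distrib, Finset.sum_add_distrib, ← Finset.mul_sum, hp.2, h1]; simp
  have h4 := Finset.single_le_sum (f := fun j => n * p j + 1 - gc i0 p n j)
    (fun j _ => by linarith [h2 j]) (Finset.mem_univ i)
  simp only [h3] at h4
  linarith

lemma cnt_modify {N : ℕ} (e e' : ℕ → Fin N) (M : ℕ) (h : ∀ m, M ≤ m → e' m = e m)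
    (i : Fin N) (n : ℕ) : |cnt e' i n - cnt e i n| ≤ M := by
  have key : ∀ n, |cnt e' i n - cnt e i n| ≤ min (n : ℝ) (M : ℝ) := by
    intro n
    induction n with
    | zero => simp [cnt]
    | succ n ih =>
      unfold cnt at ih ⊢
      rw [Finset.sum_range_succ, Finset.sum_range_succ]
      rcases le_or_gt M n with hM | hM
      · rw [h n hM, add_sub_add_right_eq_sub]
        refine ih.trans ?_
        push_cast
        exact min_le_min (by linarith) le_rfl
      · have h1 : (n : ℝ) + 1 ≤ M := by exact_mod_cast hM
        rw [min_eq_left (by linarith)] at ih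
        push_cast
        rw [min_eq_left h1]
        rw [abs_le] at ih ⊢
        split_ifs <;> constructor <;> linarith [ih.1, ih.2]
  exact (key n).trans (min_le_right _ _)

lemma freq_tendsto {N : ℕ} (e : ℕ → Fin N) (i : Fin N) (p C : ℝ)
    (h : ∀ n : ℕ, |cnt e i n - n * p| ≤ C) :
    Tendsto (fun n : ℕ => bfreq (fun _ => e) 0 [i] n) atTop (𝓝 p) := by
  rw [tendsto_iff_dist_tendsto_zero]
  refine squeeze_zero' (Eventually.of_forall fun _ => dist_nonneg) ?_
    (tendsto_const_div_atTop_nhds_zero_nat C)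
  filter_upwards [eventually_gt_atTop 0] with n hn
  have hn' : (0 : ℝ) < n := by exact_mod_cast hn
  rw [bfreq_single, Real.dist_eq, le_div_iff₀ hn', ← abs_of_pos hn', ← abs_mul, abs_of_pos hn']
  refine le_trans (le_of_eq ?_) (h n)
  unfold cnt
  congr 1
  field_simp

/-- integer formed by the first `L` digits -/
def pre {N : ℕ} (e : ℕ → Fin N) : ℕ → ℕ
  | 0 => 0
  | L + 1 => N * pre e L + (e L : ℕ)

lemma pre_inj {N : ℕ} (e e' : ℕ → Fin N) (L : ℕ) (h : pre e L = pre e' L) :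
    ∀ k < L, e k = e' k := by
  induction L with
  | zero => intro k hk; omega
  | succ L ih =>
    simp only [pre] at h
    have hpos : 0 < N := lt_of_le_of_lt (Nat.zero_le _) (e L).2
    have h1 : (e L : ℕ) = e' L := by
      have := congrArg (· % N) h
      simpa [Nat.mul_add_mod, Nat.mod_eq_of_lt] using this
    have h2 : pre e L = pre e' L := by
      rw [h1] at h
      exact Nat.eq_of_mul_eq_mul_left hpos (Nat.add_right_cancel h)
    intro k hk
    rcases Nat.lt_succ_iff_lt_or_eq.1 hk with hk | rfl
    · exact ih h2 k hk
    · exact Fin.ext h1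

lemma pre_lt {N : ℕ} (e : ℕ → Fin N) (L : ℕ) : pre e L + 1 ≤ N ^ L := by
  induction L with
  | zero => simp [pre]
  | succ L ih =>
    have := (e L).2
    simp only [pre, pow_succ]
    nlinarith

lemma pre_congr {N : ℕ} (e e' : ℕ → Fin N) (L : ℕ) (h : ∀ k < L, e k = e' k) :
    pre e L = pre e' L := by
  induction L with
  | zero => rfl
  | succ L ih => simp only [pre]; rw [ih fun k hk => h k (by omega), h L (by omega)]

lemma pre_sum {N : ℕ} (hN : 2 ≤ N) (e : ℕ → Fin N) (L : ℕ) :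
    ∑ h ∈ Finset.range L, (e h : ℝ) / (N : ℝ) ^ (h + 1) = pre e L / (N : ℝ) ^ L := by
  have hN' : (N : ℝ) ≠ 0 := by positivity
  induction L with
  | zero => simp [pre]
  | succ L ih =>
    rw [Finset.sum_range_succ, ih]
    simp only [pre]
    push_cast
    rw [pow_succ]
    field_simp

lemma pre_bounds {N : ℕ} (hN : 2 ≤ N) (e : ℕ → Fin N) (x : ℝ)
    (hx : HasSum (fun h : ℕ => (e h : ℝ) / (N : ℝ) ^ (h + 1)) x) (L : ℕ) :
    (pre e L : ℝ) / (N : ℝ) ^ L ≤ x ∧ x ≤ ((pre e L : ℝ) + 1) / (N : ℝ) ^ L := by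
  have hN' : (0 : ℝ) < N := by positivity
  constructor
  · rw [← pre_sum hN]
    exact sum_le_hasSum _ (fun i _ => by positivity) hx
  · have ht := hx.tendsto_sum_nat
    refine le_of_tendsto ht ?_
    filter_upwards [eventually_ge_atTop L] with m hm
    rw [pre_sum hN]
    have key : ((pre e m : ℝ) + 1) / (N : ℝ) ^ m ≤ ((pre e L : ℝ) + 1) / (N : ℝ) ^ L := by
      induction m, hm using Nat.le_induction with
      | base => exact le_rfl
      | succ m hm ih =>
        refine le_trans ?_ ih
        have h1 : ((e m : ℕ) : ℝ) + 1 ≤ N := by exact_mod_cast (e m).2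
        simp only [pre]
        push_cast
        rw [pow_succ, div_le_div_iff₀ (by positivity) (by positivity)]
        have : (0 : ℝ) < (N : ℝ) ^ m := by positivity
        nlinarith
    refine le_trans ?_ key
    gcongr
    linarith

lemma digits_eq {N : ℕ} (hN : 2 ≤ N) (d : ℝ → ℕ → Fin N) (hd : IsNonTerminatingDigits d)
    (e : ℕ → Fin N) (L : ℕ) (y : ℝ) (hy : y ∈ Set.Ico (0 : ℝ) 1)
    (h1 : (pre e L : ℝ) / (N : ℝ) ^ L < y) (h2 : y < ((pre e L : ℝ) + 1) / (N : ℝ) ^ L) :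
    ∀ k < L, d y k = e k := by
  obtain ⟨h3, h4⟩ := pre_bounds hN (d y) y (hd y hy).1 L
  have hp : (0 : ℝ) < (N : ℝ) ^ L := by positivity
  apply pre_inj
  have a := lt_of_lt_of_le h1 h4
  have b := lt_of_le_of_lt h3 h2
  rw [div_lt_div_iff_of_pos_right hp] at a b
  have a' : pre e L < pre (d y) L + 1 := by exact_mod_cast a
  have b' : pre (d y) L < pre e L + 1 := by exact_mod_cast b
  omega

lemma mem_res {N : ℕ} (hN : 2 ≤ N) (r : ℕ)
    (d : ℝ → ℕ → Fin N) (hd : IsNonTerminatingDigits d) (p : Fin N → ℝ)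
    (hp : p ∈ Simplex (Fin N)) (ε : ℝ) (hε : 0 < ε) (n₀ : ℕ) :
    {y : ↥(Set.Ico (0 : ℝ) 1) | ∃ n, n₀ ≤ n ∧ dist1 (bcfreqVec d (y : ℝ) r n) p < ε}
      ∈ residual ↥(Set.Ico (0 : ℝ) 1) := by
  refine mem_of_superset (residual_of_dense_open isOpen_interior ?_) interior_subset
  rw [Metric.dense_iff]
  intro x δ hδ
  have hN1 : (1 : ℝ) < N := by exact_mod_cast (by omega : 1 < N)
  have hN0 : (0 : ℝ) < N := by linarith
  obtain ⟨M, hM⟩ := exists_pow_lt_of_lt_one hδ (inv_lt_one_of_one_lt₀ hN1)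
  obtain ⟨e0, he0⟩ := exists_seq hN p hp
  let e : ℕ → Fin N := fun k => if k < M then d x k else e0 k
  have he : ∀ i n, |cnt e i n - n * p i| ≤ M + N := by
    intro i n
    have h1 := cnt_modify e0 e M (fun m hm => by simp [e, not_lt.2 hm]) i n
    have h2 := he0 i n
    have := abs_sub_le (cnt e i n) (cnt e0 i n) (n * p i)
    linarith
  have ht : Tendsto (fun n => dist1 (bcfreqVec (fun _ => e) 0 r n) p) atTop (𝓝 0) := by
    unfold dist1
    have : ∀ b ∈ (Finset.univ : Finset (Fin N)),
        Tendsto (fun n => |bcfreqVec (fun _ => e) 0 r n b - p b|) atTop (𝓝 0) := by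
      intro b _
      have h1 := bcfreq_tendsto (fun _ => e) 0 b (p b) (freq_tendsto e b (p b) _ (he b)) r
      have h2 := (h1.sub_const (p b)).abs
      simpa [bcfreqVec] using h2
    simpa using tendsto_finsetSum _ this
  obtain ⟨L, hL1, hL2, hL3⟩ := ((ht.eventually_lt_const hε).and
    ((eventually_ge_atTop n₀).and (eventually_ge_atTop M))).exists
  have hP : (0 : ℝ) < (N : ℝ) ^ L := by positivity
  let W : Set ↥(Set.Ico (0 : ℝ) 1) := {y | (y : ℝ) ∈
    Set.Ioo ((pre e L : ℝ) / (N : ℝ) ^ L) (((pre e L : ℝ) + 1) / (N : ℝ) ^ L)}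
  have hWo : IsOpen W := isOpen_Ioo.preimage continuous_subtype_val
  have hWd : ∀ y ∈ W, ∀ k < L, d y k = e k := fun y hy =>
    digits_eq hN d hd e L y y.2 hy.1 hy.2
  have hWs : W ⊆ {y : ↥(Set.Ico (0 : ℝ) 1) | ∃ n, n₀ ≤ n ∧
      dist1 (bcfreqVec d (y : ℝ) r n) p < ε} := by
    intro y hy
    refine ⟨L, hL2, ?_⟩
    have : bcfreqVec d (y : ℝ) r L = bcfreqVec (fun _ => e) 0 r L := by
      funext i
      exact bcfreq_congr _ _ _ _ r i L (hWd y hy)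
    rw [this]; exact hL1
  have hlt : (pre e L : ℝ) / (N : ℝ) ^ L < ((pre e L : ℝ) + 1) / (N : ℝ) ^ L := by
    gcongr; linarith
  obtain ⟨y, hy1, hy2⟩ := exists_between hlt
  have hy0 : (0 : ℝ) ≤ y := le_trans (by positivity) hy1.le
  have hyl : y < 1 := by
    refine lt_of_lt_of_le hy2 ?_
    rw [div_le_one hP]
    exact_mod_cast pre_lt e L
  have hyW : (⟨y, hy0, hyl⟩ : ↥(Set.Ico (0 : ℝ) 1)) ∈ W := ⟨hy1, hy2⟩
  refine ⟨⟨y, hy0, hyl⟩, ?_, mem_interior.2 ⟨W, hWs, hWo, hyW⟩⟩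
  rw [Metric.mem_ball, Subtype.dist_eq, Real.dist_eq]
  refine lt_of_le_of_lt ?_ hM
  have hpe : pre (d y) M = pre (d x) M := by
    refine pre_congr _ _ _ fun k hk => ?_
    have := hWd _ hyW k (by omega)
    simpa [e, hk] using this
  obtain ⟨b1, b2⟩ := pre_bounds hN (d y) y (hd y ⟨hy0, hyl⟩).1 M
  obtain ⟨b3, b4⟩ := pre_bounds hN (d x) x (hd x x.2).1 M
  rw [hpe] at b1 b2
  rw [add_div] at b2 b4
  rw [inv_pow, ← one_div, abs_le]
  constructor <;> simp only <;> linarith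

lemma dist1_triangle {N : ℕ} (a b c : Fin N → ℝ) : dist1 a c ≤ dist1 a b + dist1 b c := by
  unfold dist1
  rw [← Finset.sum_add_distrib]
  exact Finset.sum_le_sum fun i _ => abs_sub_le _ _ _

/-- the set of `x ∈ [0,1)` such that the set of accumulation points
of `(Π_1^{(r)}(x,n))_n` equals the full simplex `Δ_1` is residual in `[0,1)`. -/
theorem cesaro_extremely_nonnormal_residual_baseN
    {N : ℕ} (hN : 2 ≤ N) (r : ℕ) (hr : 1 ≤ r)
    (d : ℝ → ℕ → Fin N) (hd : IsNonTerminatingDigits d) :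
    {y : ↥(Set.Ico (0 : ℝ) 1) |
        AccPts (fun n => bcfreqVec d (y : ℝ) r n) = Simplex (Fin N)}
      ∈ residual ↥(Set.Ico (0 : ℝ) 1) := by
  obtain ⟨S, hSc, hSd⟩ := TopologicalSpace.exists_countable_dense ↥(Simplex (Fin N))
  have hall : ∀ᶠ y : ↥(Set.Ico (0 : ℝ) 1) in residual ↥(Set.Ico (0 : ℝ) 1),
      ∀ q ∈ S, ∀ m n₀ : ℕ, ∃ n, n₀ ≤ n ∧
        dist1 (bcfreqVec d (y : ℝ) r n) (q : Fin N → ℝ) < 1 / ((m : ℝ) + 1) := by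
    rw [eventually_countable_ball hSc]
    intro q hq
    rw [eventually_countable_forall]
    intro m
    rw [eventually_countable_forall]
    intro n₀
    exact mem_res hN r d hd q q.2 _ (by positivity) n₀
  filter_upwards [hall] with y hy
  refine Set.Subset.antisymm (fun p hp => hp.1) fun p hp => ⟨hp, fun ε hε n₀ => ?_⟩
  obtain ⟨m, hm⟩ := exists_nat_one_div_lt (half_pos hε)
  have hcont : Continuous fun q : ↥(Simplex (Fin N)) => dist1 (q : Fin N → ℝ) p := by
    unfold dist1
    refine continuous_finsetSum _ fun b _ => Continuous.abs (Continuous.sub ?_ continuous_const)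
    exact (continuous_apply b).comp continuous_subtype_val
  have hopen : IsOpen {q : ↥(Simplex (Fin N)) | dist1 (q : Fin N → ℝ) p < ε / 2} :=
    isOpen_lt hcont continuous_const
  obtain ⟨q, hq1, hq2⟩ := hSd.inter_open_nonempty _ hopen
    ⟨⟨p, hp⟩, by simp [dist1, hε]⟩
  obtain ⟨n, hn1, hn2⟩ := hy q hq2 m n₀
  refine ⟨n, hn1, ?_⟩
  have := dist1_triangle (bcfreqVec d (y : ℝ) r n) q p
  have hq1' : dist1 (q : Fin N → ℝ) p < ε / 2 := hq1
  linarith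

end BaseN
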